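/- In the LIBE framework below, assume the discrete inf-sup condition holds with constant α > 0: for every q ∈ Q_h, α ‖q‖_Q ≤ sup over nonzero v ∈ X_h of d(v, q)/‖G v‖. Let N ≥ 1, S := (Δt Σ_{n=0}^{N−1} F_{n+1}²)^{1/2}, C_h := max over 0 ≤ n ≤ N−1 of ‖G u^n‖, and assume the energy bound of Theorem 4.1 in the form ν Δt Σ_{n=0}^{N} ‖G u^n‖² ≤ ν^{-1} S² + ‖u⁰‖². Then the pressure approximation satisfies α (Δt Σ_{n=0}^{N−1} ‖p^{n+1}‖_Q²)^{1/2} ≤ √3 (1 + C_*^{-1}) [ √(C₁² C_h² ν^{-2} + 1) · S + √(C₁² C_h² ν^{-1} + ν) · ‖u⁰‖ ]. -/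

import Mathlib

open scoped RealInnerProductSpace

/-- The dual norm `‖w‖_{S*} := sup over nonzero v ∈ S of ⟪w, v⟫ / ‖G v‖`. -/
noncomputable def dualNorm {X Y : Type*} [NormedAddCommGroup X] [InnerProductSpace ℝ X]
    [NormedAddCommGroup Y] [InnerProductSpace ℝ Y]
    (G : X →ₗ[ℝ] Y) (S : Set X) (w : X) : ℝ :=
  ⨆ v : {v : X // v ∈ S ∧ v ≠ 0}, ⟪w, (v : X)⟫ / ‖G (v : X)‖

section DualNorm

variable {X Y : Type*} [NormedAddCommGroup X] [InnerProductSpace ℝ X]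
  [NormedAddCommGroup Y] [InnerProductSpace ℝ Y]

theorem dualNorm_le {G : X →ₗ[ℝ] Y} {S : Set X} {w : X} {K : ℝ} (hK : 0 ≤ K)
    (h : ∀ v ∈ S, ⟪w, v⟫ ≤ K * ‖G v‖) : dualNorm G S w ≤ K :=
  Real.iSup_le (fun v => div_le_of_le_mul₀ (norm_nonneg _) hK (h v v.2.1)) hK

theorem inner_le_dualNorm_mul {G : X →ₗ[ℝ] Y} {Xh : Submodule ℝ X} [FiniteDimensional ℝ Xh]
    (hG : ∀ v ∈ Xh, G v = 0 → v = 0) (w : X) {v : X} (hv : v ∈ Xh) :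
    ⟪w, v⟫ ≤ dualNorm G (Xh : Set X) w * ‖G v‖ := by
  rcases eq_or_ne v 0 with rfl | hv0
  · simp
  have hker : LinearMap.ker (G.domRestrict Xh) = ⊥ := by
    rw [LinearMap.ker_eq_bot']
    exact fun x hx => Subtype.ext (hG x x.2 hx)
  obtain ⟨K, -, hK⟩ := (G.domRestrict Xh).exists_antilipschitzWith hker
  have hbound : ∀ x ∈ Xh, ‖x‖ ≤ K * ‖G x‖ := fun x hx => by
    simpa using hK.le_mul_dist ⟨x, hx⟩ 0
  have hbdd : BddAbove (Set.range fun x : {x : X // x ∈ (Xh : Set X) ∧ x ≠ 0} =>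
      ⟪w, (x : X)⟫ / ‖G (x : X)‖) := by
    refine ⟨‖w‖ * K, ?_⟩
    rintro _ ⟨x, rfl⟩
    refine div_le_of_le_mul₀ (norm_nonneg _) (by positivity) ?_
    calc ⟪w, (x : X)⟫ ≤ ‖w‖ * ‖(x : X)‖ := real_inner_le_norm _ _
      _ ≤ ‖w‖ * (K * ‖G x‖) := by gcongr; exact hbound x x.2.1
      _ = ‖w‖ * K * ‖G x‖ := by ring
  have hpos : 0 < ‖G v‖ := norm_pos_iff.mpr fun h => hv0 (hG v hv h)
  rw [← div_le_iff₀ hpos]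
  exact le_ciSup hbdd ⟨v, hv, hv0⟩

/-- A functional `φ` bounded by `F ‖G ·‖` behaves like `⟪f, G ·⟫` with `‖f‖ ≤ F`, so that
`ν ⟪G x, G ·⟫ - φ` is controlled by the expansion of `‖ν G x - f‖²`. -/
theorem sq_inner_sub_le {G : X →ₗ[ℝ] Y} {φ : X →ₗ[ℝ] ℝ} {F : ℝ}
    (hφ : ∀ v, |φ v| ≤ F * ‖G v‖) (ν : ℝ) (x v : X) :
    (ν * ⟪G x, G v⟫ - φ v) ^ 2 ≤
      (ν ^ 2 * ‖G x‖ ^ 2 - 2 * ν * φ x + F ^ 2) * ‖G v‖ ^ 2 := by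
  have hφv := hφ v
  rcases eq_or_ne (G v) 0 with h0 | h0
  · have : φ v = 0 := by simpa [h0] using hφv
    simp [h0, this]
  have hpos : 0 < ‖G v‖ ^ 2 := by positivity
  set c := ν * ⟪G x, G v⟫ - φ v with hc
  set t := c / ‖G v‖ ^ 2 with ht
  have htc : t * ‖G v‖ ^ 2 = c := div_mul_cancel₀ _ hpos.ne'
  have hz := (le_abs_self _).trans (hφ (ν • x - t • v))
  have hsq : ‖G (ν • x - t • v)‖ ^ 2 =
      ν ^ 2 * ‖G x‖ ^ 2 - 2 * t * (ν * ⟪G x, G v⟫) + t ^ 2 * ‖G v‖ ^ 2 := by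
    rw [map_sub, map_smul, map_smul, norm_sub_sq_real, norm_smul, norm_smul,
      real_inner_smul_left, real_inner_smul_right, mul_pow, mul_pow, Real.norm_eq_abs,
      Real.norm_eq_abs, sq_abs, sq_abs]
    ring
  have hyoung := two_mul_le_add_sq F ‖G (ν • x - t • v)‖
  rw [hsq] at hyoung
  simp only [map_sub, map_smul, smul_eq_mul] at hz hyoung
  have key : t * c ≤ ν ^ 2 * ‖G x‖ ^ 2 - 2 * ν * φ x + F ^ 2 := by
    have h1 : t ^ 2 * ‖G v‖ ^ 2 = t * c := by rw [← htc]; ring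
    have h2 : t * c = t * (ν * ⟪G x, G v⟫) - t * φ v := by rw [hc]; ring
    linarith
  calc c ^ 2 = t * c * ‖G v‖ ^ 2 := by rw [← htc]; ring
    _ ≤ _ := by gcongr

end DualNorm

/-- Corollary 4.2, second assertion (abstract form): `L²(0,t*;L²)` stability of the LIBE
pressure approximation, assuming the energy bound of Theorem 4.1, with
`C_h = max_{0 ≤ n ≤ N−1} ‖G u^n‖`. -/
theorem libe_pressure_L2_stability
    {X Y Q : Type*}
    [NormedAddCommGroup X] [InnerProductSpace ℝ X]
    [NormedAddCommGroup Y] [InnerProductSpace ℝ Y]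
    [NormedAddCommGroup Q] [NormedSpace ℝ Q]
    (G : X →ₗ[ℝ] Y)
    (Xh : Submodule ℝ X) [FiniteDimensional ℝ Xh]
    (hGinj : ∀ v ∈ Xh, G v = 0 → v = 0)
    (Qh : Submodule ℝ Q)
    (d : X →ₗ[ℝ] Q →ₗ[ℝ] ℝ)
    (Cstar : ℝ) (hCstar : 0 < Cstar)
    (hdual : ∀ w ∈ {v : X | v ∈ Xh ∧ ∀ q ∈ Qh, d v q = 0},
      Cstar * dualNorm G (Xh : Set X) w
        ≤ dualNorm G {v : X | v ∈ Xh ∧ ∀ q ∈ Qh, d v q = 0} w)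
    (b : X →ₗ[ℝ] X →ₗ[ℝ] X →ₗ[ℝ] ℝ)
    (hbskew : ∀ u w : X, b u w w = 0)
    (C₁ : ℝ) (hb : ∀ u v w : X, |b u v w| ≤ C₁ * ‖G u‖ * ‖G v‖ * ‖G w‖)
    (Δt ν : ℝ) (hΔt : 0 < Δt) (hν : 0 < ν)
    (ℓ : ℕ → X →ₗ[ℝ] ℝ) (F : ℕ → ℝ)
    (hℓ : ∀ n, 1 ≤ n → ∀ v : X, |ℓ n v| ≤ F n * ‖G v‖)
    (u : ℕ → X) (p : ℕ → Q)
    (hu : ∀ n, u n ∈ Xh) (hp : ∀ n, p n ∈ Qh)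
    (hscheme : ∀ n : ℕ, ∀ v ∈ Xh,
      ⟪u (n + 1) - u n, v⟫ + Δt * b (u n) (u (n + 1)) v
        + Δt * ν * ⟪G (u (n + 1)), G v⟫ - Δt * d v (p (n + 1)) = Δt * ℓ (n + 1) v)
    (hdiv : ∀ n : ℕ, ∀ q ∈ Qh, d (u (n + 1)) q = 0)
    (hdiv0 : ∀ q ∈ Qh, d (u 0) q = 0)
    (α : ℝ) (hα : 0 < α)
    (hinfsup : ∀ q ∈ Qh,
      α * ‖q‖ ≤ ⨆ v : {v : X // v ∈ Xh ∧ v ≠ 0}, d (v : X) q / ‖G (v : X)‖)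
    (N : ℕ) (hN : 1 ≤ N)
    (S Ch : ℝ)
    (hS : S = Real.sqrt (Δt * ∑ n ∈ Finset.range N, F (n + 1) ^ 2))
    (hCh : Ch = (Finset.range N).sup'
      (Finset.nonempty_range_iff.mpr (Nat.one_le_iff_ne_zero.mp hN))
      (fun n => ‖G (u n)‖))
    (henergy : ν * Δt * ∑ n ∈ Finset.range (N + 1), ‖G (u n)‖ ^ 2 ≤ ν⁻¹ * S ^ 2 + ‖u 0‖ ^ 2) :
    α * Real.sqrt (Δt * ∑ n ∈ Finset.range N, ‖p (n + 1)‖ ^ 2)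
      ≤ Real.sqrt 3 * (1 + Cstar⁻¹)
          * (Real.sqrt (C₁ ^ 2 * Ch ^ 2 * ν⁻¹ ^ 2 + 1) * S
            + Real.sqrt (C₁ ^ 2 * Ch ^ 2 * ν⁻¹ + ν) * ‖u 0‖) := by
  have hCstar' : 0 < Cstar⁻¹ := inv_pos.mpr hCstar
  set R : ℕ → ℝ := fun n =>
    ν ^ 2 * ‖G (u (n + 1))‖ ^ 2 - 2 * ν * ℓ (n + 1) (u (n + 1)) + F (n + 1) ^ 2 with hR
  set B : ℝ := |C₁| * Ch with hB
  have hCh_le : ∀ n < N, ‖G (u n)‖ ≤ Ch := fun n hn => by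
    rw [hCh]
    exact Finset.le_sup' (fun n => ‖G (u n)‖) (Finset.mem_range.mpr hn)
  have hB0 : 0 ≤ B := mul_nonneg (abs_nonneg _) ((norm_nonneg _).trans (hCh_le 0 (by omega)))
  have hBsq : B ^ 2 = C₁ ^ 2 * Ch ^ 2 := by rw [hB, mul_pow, sq_abs]
  have hudiv : ∀ n, ∀ q ∈ Qh, d (u n) q = 0 := by
    rintro (_ | n)
    exacts [hdiv0, hdiv n]
  have hR0 : ∀ n, 0 ≤ R n := fun n => by
    have h1 := (le_abs_self _).trans (hℓ (n + 1) (by omega) (ν • u (n + 1)))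
    have h2 := two_mul_le_add_sq (F (n + 1)) ‖G (ν • u (n + 1))‖
    rw [map_smul, norm_smul, mul_pow, Real.norm_eq_abs, sq_abs] at h2
    rw [map_smul, map_smul, norm_smul, Real.norm_eq_abs, smul_eq_mul] at h1
    simp only [hR]
    linarith
  have hpressure : ∀ n < N, α * ‖p (n + 1)‖ ≤
      (1 + Cstar⁻¹) * (B * ‖G (u (n + 1))‖ + √(R n)) := fun n hn => by
    set K := B * ‖G (u (n + 1))‖ + √(R n) with hK
    have hK0 : 0 ≤ K := by positivity
    have hres : ∀ v, |b (u n) (u (n + 1)) v + (ν * ⟪G (u (n + 1)), G v⟫ - ℓ (n + 1) v)| ≤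
        K * ‖G v‖ := fun v => by
      have h1 : |b (u n) (u (n + 1)) v| ≤ B * ‖G (u (n + 1))‖ * ‖G v‖ := by
        refine (hb _ _ _).trans ?_
        gcongr
        exact mul_le_mul (le_abs_self _) (hCh_le n hn) (norm_nonneg _) (abs_nonneg _)
      have h2 : |ν * ⟪G (u (n + 1)), G v⟫ - ℓ (n + 1) v| ≤ √(R n) * ‖G v‖ := by
        refine abs_le_of_sq_le_sq ?_ (by positivity)
        rw [mul_pow, Real.sq_sqrt (hR0 n)]
        exact sq_inner_sub_le (hℓ (n + 1) (by omega)) ν _ v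
      calc _ ≤ _ := abs_add_le _ _
        _ ≤ _ := add_le_add h1 h2
        _ = K * ‖G v‖ := by rw [hK]; ring
    have hdualX : dualNorm G (Xh : Set X) (u (n + 1) - u n) ≤ Cstar⁻¹ * (Δt * K) := by
      rw [← div_eq_inv_mul, le_div_iff₀' hCstar]
      refine (hdual _ ⟨Xh.sub_mem (hu _) (hu _), fun q hq => ?_⟩).trans
        (dualNorm_le (by positivity) ?_)
      · rw [map_sub, LinearMap.sub_apply, hudiv _ q hq, hudiv _ q hq, sub_zero]
      · rintro v ⟨hv, hvd⟩
        have h1 := hscheme n v hv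
        rw [hvd _ (hp _)] at h1
        have h2 := mul_le_mul_of_nonneg_left (abs_le.mp (hres v)).1 hΔt.le
        linarith
    refine (hinfsup _ (hp _)).trans (Real.iSup_le (fun v => ?_) (by positivity))
    refine div_le_of_le_mul₀ (norm_nonneg _) (by positivity) ?_
    have h1 := hscheme n v v.2.1
    have h2 := mul_le_mul_of_nonneg_left (abs_le.mp (hres v)).2 hΔt.le
    have h3 := (inner_le_dualNorm_mul hGinj (u (n + 1) - u n) v.2.1).trans
      (mul_le_mul_of_nonneg_right hdualX (norm_nonneg _))
    refine le_of_mul_le_mul_left ?_ hΔt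
    linarith
  have hstep : ∀ n, Δt * R n ≤ Δt * F (n + 1) ^ 2 - ν * (‖u (n + 1)‖ ^ 2 - ‖u n‖ ^ 2) := fun n => by
    have h1 := hscheme n _ (hu (n + 1))
    rw [hbskew, hdiv n _ (hp _), real_inner_self_eq_norm_sq, inner_sub_left,
      real_inner_self_eq_norm_sq] at h1
    have h2 := (real_inner_le_norm (u n) (u (n + 1))).trans
      (by linarith [two_mul_le_add_sq ‖u n‖ ‖u (n + 1)‖] :
        _ ≤ (‖u n‖ ^ 2 + ‖u (n + 1)‖ ^ 2) / 2)
    have h3 : ν * (Δt * ℓ (n + 1) (u (n + 1)) - Δt * ν * ‖G (u (n + 1))‖ ^ 2) ≥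
        ν * ((‖u (n + 1)‖ ^ 2 - ‖u n‖ ^ 2) / 2) :=
      mul_le_mul_of_nonneg_left (by linarith) hν.le
    have h4 : 0 ≤ Δt * ν ^ 2 * ‖G (u (n + 1))‖ ^ 2 := by positivity
    simp only [hR]
    linarith
  have hS0 : 0 ≤ S := hS ▸ Real.sqrt_nonneg _
  have hSsq : S ^ 2 = Δt * ∑ n ∈ Finset.range N, F (n + 1) ^ 2 := by
    rw [hS, Real.sq_sqrt (mul_nonneg hΔt.le (Finset.sum_nonneg fun n _ => sq_nonneg _))]
  have hRsum : Δt * ∑ n ∈ Finset.range N, R n ≤ S ^ 2 + ν * ‖u 0‖ ^ 2 := by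
    have h := Finset.sum_le_sum fun n (_ : n ∈ Finset.range N) => hstep n
    rw [Finset.sum_sub_distrib, ← Finset.mul_sum, ← Finset.mul_sum, ← Finset.mul_sum,
      Finset.sum_range_sub (fun n => ‖u n‖ ^ 2), ← hSsq] at h
    have : 0 ≤ ν * ‖u N‖ ^ 2 := by positivity
    linarith
  have hGsum : Δt * ∑ n ∈ Finset.range N, ‖G (u (n + 1))‖ ^ 2 ≤
      ν⁻¹ ^ 2 * S ^ 2 + ν⁻¹ * ‖u 0‖ ^ 2 := by
    rw [Finset.sum_range_succ'] at henergy
    have h0 : 0 ≤ Δt * ‖G (u 0)‖ ^ 2 := by positivity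
    have h := mul_le_mul_of_nonneg_left henergy (inv_nonneg.mpr hν.le)
    rw [mul_assoc ν, inv_mul_cancel_left₀ hν.ne'] at h
    linarith
  set a := C₁ ^ 2 * Ch ^ 2 * ν⁻¹ ^ 2 + 1 with ha
  set c := C₁ ^ 2 * Ch ^ 2 * ν⁻¹ + ν with hc
  have ha0 : 0 ≤ a := by positivity
  have hc0 : 0 ≤ c := by positivity
  have hsum : α ^ 2 * (Δt * ∑ n ∈ Finset.range N, ‖p (n + 1)‖ ^ 2) ≤
      (1 + Cstar⁻¹) ^ 2 * (2 * (a * S ^ 2 + c * ‖u 0‖ ^ 2)) := by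
    calc α ^ 2 * (Δt * ∑ n ∈ Finset.range N, ‖p (n + 1)‖ ^ 2)
        = Δt * ∑ n ∈ Finset.range N, (α * ‖p (n + 1)‖) ^ 2 := by
          simp only [mul_pow, ← Finset.mul_sum]
          ring
      _ ≤ Δt * ∑ n ∈ Finset.range N,
            (1 + Cstar⁻¹) ^ 2 * (2 * (B ^ 2 * ‖G (u (n + 1))‖ ^ 2 + R n)) := by
          gcongr with n hn
          refine (pow_le_pow_left₀ (by positivity)
            (hpressure n (Finset.mem_range.mp hn)) 2).trans ?_
          rw [mul_pow]
          gcongr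
          refine add_sq_le.trans_eq ?_
          rw [mul_pow, Real.sq_sqrt (hR0 n)]
      _ = (1 + Cstar⁻¹) ^ 2 * (2 * (B ^ 2 * (Δt * ∑ n ∈ Finset.range N, ‖G (u (n + 1))‖ ^ 2)
            + Δt * ∑ n ∈ Finset.range N, R n)) := by
          simp only [← Finset.mul_sum, Finset.sum_add_distrib]
          ring
      _ ≤ (1 + Cstar⁻¹) ^ 2 * (2 * (B ^ 2 * (ν⁻¹ ^ 2 * S ^ 2 + ν⁻¹ * ‖u 0‖ ^ 2)
            + (S ^ 2 + ν * ‖u 0‖ ^ 2))) := by gcongr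
      _ = _ := by rw [hBsq, ha, hc]; ring
  refine (sq_le_sq₀ (by positivity) (by positivity)).mp ?_
  rw [mul_pow, Real.sq_sqrt (mul_nonneg hΔt.le (Finset.sum_nonneg fun n _ => sq_nonneg _))]
  refine hsum.trans ?_
  rw [mul_pow, mul_pow, Real.sq_sqrt zero_le_three, mul_comm (3 : ℝ), mul_assoc]
  gcongr
  · norm_num
  · rw [add_sq, mul_pow, mul_pow, Real.sq_sqrt ha0, Real.sq_sqrt hc0]
    have : 0 ≤ 2 * (√a * S) * (√c * ‖u 0‖) := by positivity
    linarith
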